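/- Let $2 \leq r \leq n$ and let $\Delta$ be an $n$-dimensional simplex in $\mathbb{R}^n$. For all convex bodies $P_1,\dots,P_r$ in $\mathbb{R}^n$: $|\Delta|^{r-1} V(P_1,\dots,P_r,\Delta[n-r]) \leq \prod_{i=1}^r V(P_i, \Delta[n-1])$. -/

import Mathlib

open scoped Pointwise
open MeasureTheory

/-- A convex body in `ℝⁿ`: a compact convex set with nonempty interior. -/
def IsConvexBody {n : ℕ} (K : Set (EuclideanSpace ℝ (Fin n))) : Prop :=
  Convex ℝ K ∧ IsCompact K ∧ (interior K).Nonempty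

/-- The mixed volume of `n` convex bodies in `ℝⁿ`, via the
inclusion-exclusion (polarization) formula for Minkowski sums. -/
noncomputable def mixedVolume {n : ℕ} (K : Fin n → Set (EuclideanSpace ℝ (Fin n))) : ℝ :=
  ((n.factorial : ℝ))⁻¹ *
    ∑ S : Finset (Fin n), (-1 : ℝ) ^ (n + S.card) * (volume (∑ i ∈ S, K i)).toReal

section MixedDisc
variable {n : ℕ}

/-- Mixed discriminant (up to the factor `n!`). -/
noncomputable def mdisc (A : Fin n → Matrix (Fin n) (Fin n) ℝ) : ℝ :=
  ∑ S : Finset (Fin n), (-1 : ℝ) ^ (n + S.card) * (∑ i ∈ S, A i).det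

lemma sum_superset_sign (T : Finset (Fin n)) :
    ∑ S : Finset (Fin n), (if T ⊆ S then (-1 : ℝ) ^ (n + S.card) else 0) =
      if T = Finset.univ then 1 else 0 := by
  have h1 : ∑ S : Finset (Fin n), (if T ⊆ S then (-1 : ℝ) ^ (n + S.card) else 0) =
      ∑ S : Finset (Fin n), (if S ⊆ Tᶜ then (-1 : ℝ) ^ (S.card) else 0) := by
    refine Finset.sum_bijective (fun S : Finset (Fin n) => Sᶜ) compl_bijective (by simp) ?_
    intro S _
    have h2 : (Sᶜ ⊆ Tᶜ) ↔ T ⊆ S := Finset.compl_subset_compl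
    simp only [h2]
    have h3 : S.card + Sᶜ.card = n := by simp
    split_ifs
    · have : n + S.card = Sᶜ.card + 2 * S.card := by omega
      rw [this, pow_add, pow_mul]; simp
    · rfl
  rw [h1, ← Finset.sum_filter]
  have h4 : (Finset.univ.filter fun S : Finset (Fin n) => S ⊆ Tᶜ) = (Tᶜ).powerset := by
    ext S; simp
  rw [h4]
  have h5 := congrArg (fun z : ℤ => (z : ℝ)) (Finset.sum_powerset_neg_one_pow_card (x := Tᶜ))
  simp only [Finset.compl_eq_empty_iff] at h5
  push_cast at h5
  rw [h5]

lemma mdisc_eq_perm (A : Fin n → Matrix (Fin n) (Fin n) ℝ) :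
    mdisc A = ∑ σ : Equiv.Perm (Fin n), (Matrix.of fun j k => A (σ j) j k).det := by
  have h1 : ∀ S : Finset (Fin n), (∑ i ∈ S, A i).det =
      ∑ f : Fin n → Fin n, if (Finset.univ.image f) ⊆ S then
        (Matrix.of fun j k => A (f j) j k).det else 0 := by
    intro S
    have h := (Matrix.detRowAlternating (n := Fin n) (R := ℝ)).toMultilinearMap.map_sum_finset
      (fun j i => A i j) (fun _ => S)
    rw [← Finset.sum_filter]
    have e : (Finset.univ.filter fun f : Fin n → Fin n => Finset.univ.image f ⊆ S) =
        Fintype.piFinset (fun _ => S) := by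
      ext f; simp [Finset.subset_iff]
    rw [e]
    refine Eq.trans ?_ h
    change Matrix.det _ = Matrix.det _
    congr 1
    ext j k
    simp [Matrix.sum_apply]
  unfold mdisc
  simp_rw [h1, Finset.mul_sum]
  rw [Finset.sum_comm]
  have h2 : ∀ f : Fin n → Fin n, (∑ S : Finset (Fin n), (-1 : ℝ) ^ (n + S.card) *
      (if (Finset.univ.image f) ⊆ S then (Matrix.of fun j k => A (f j) j k).det else 0)) =
      if Function.Bijective f then (Matrix.of fun j k => A (f j) j k).det else 0 := by
    intro f
    have := sum_superset_sign (Finset.univ.image f)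
    have h3 : Finset.univ.image f = Finset.univ ↔ Function.Bijective f := by
      rw [← Finite.surjective_iff_bijective]
      simp [Finset.eq_univ_iff_forall, Function.Surjective]
    rw [if_congr h3 rfl rfl] at this
    calc _ = (∑ S : Finset (Fin n), (if (Finset.univ.image f) ⊆ S then (-1 : ℝ) ^ (n + S.card)
          else 0)) * (Matrix.of fun j k => A (f j) j k).det := by
          rw [Finset.sum_mul]; refine Finset.sum_congr rfl fun S _ => ?_
          split_ifs <;> simp
      _ = _ := by rw [this]; split_ifs <;> simp
  simp_rw [h2]
  rw [← Finset.sum_filter]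
  symm
  refine Finset.sum_bij (fun σ _ => (σ : Fin n → Fin n)) ?_ ?_ ?_ ?_
  · intro σ _; exact Finset.mem_filter.mpr ⟨Finset.mem_univ _, σ.bijective⟩
  · intro σ _ τ _ h; exact Equiv.coe_fn_injective h
  · intro f hf; exact ⟨Equiv.ofBijective f (by simpa using hf), by simp, rfl⟩
  · intro σ _; rfl

lemma mdisc_smul (c : Fin n → ℝ) (A : Fin n → Matrix (Fin n) (Fin n) ℝ) :
    mdisc (fun i => c i • A i) = (∏ i, c i) * mdisc A := by
  rw [mdisc_eq_perm, mdisc_eq_perm, Finset.mul_sum]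
  refine Finset.sum_congr rfl fun σ _ => ?_
  have := Matrix.det_mul_column (fun j => c (σ j)) (Matrix.of fun j k => A (σ j) j k)
  rw [Equiv.prod_comp σ c] at this
  rw [← this]
  congr 1

lemma mdisc_const (A : Matrix (Fin n) (Fin n) ℝ) :
    mdisc (fun _ => A) = n.factorial * A.det := by
  rw [mdisc_eq_perm]
  have : (Matrix.of fun j k => A j k) = A := rfl
  simp [this, Fintype.card_perm]

lemma mdisc_update_add (A : Fin n → Matrix (Fin n) (Fin n) ℝ) (i : Fin n)
    (B C : Matrix (Fin n) (Fin n) ℝ) :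
    mdisc (Function.update A i (B + C)) =
      mdisc (Function.update A i B) + mdisc (Function.update A i C) := by
  simp only [mdisc_eq_perm, ← Finset.sum_add_distrib]
  refine Finset.sum_congr rfl fun σ _ => ?_
  have key : ∀ X : Matrix (Fin n) (Fin n) ℝ,
      (Matrix.of fun j k => Function.update A i X (σ j) j k) =
      (Matrix.of fun j k => A (σ j) j k).updateRow (σ.symm i) (X (σ.symm i)) := by
    intro X; ext j k
    by_cases h : j = σ.symm i
    · subst h; simp
    · have : σ j ≠ i := fun h' => h (by simp [← h'])
      simp [Matrix.updateRow_ne h, this]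
  simp only [key]
  exact Matrix.det_updateRow_add _ _ _ _

lemma mdisc_nonneg (A : Fin n → Matrix (Fin n) (Fin n) ℝ) (hA : ∀ i, (A i).PosSemidef) :
    0 ≤ mdisc A := by
  have hB : ∀ i, ∃ m : ℕ, ∃ B : Fin m → (Fin n → ℝ),
      A i = ∑ k, Matrix.vecMulVec (B k) (star (B k)) := by
    intro i
    obtain ⟨m, B, h⟩ := Matrix.posSemidef_iff_eq_sum_vecMulVec.mp (hA i)
    exact ⟨m, B, h⟩
  choose m B hB using hB
  have hA' : ∀ i j k, A i j k = ∑ l, B i l j * B i l k := by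
    intro i j k
    conv_lhs => rw [hB i]
    simp [Matrix.sum_apply, Matrix.vecMulVec_apply]
  have h1 : ∀ σ : Equiv.Perm (Fin n), (Matrix.of fun j k => A (σ j) j k).det =
      ∑ κ : (∀ i, Fin (m i)), (∏ j, B (σ j) (κ (σ j)) j) *
        (Equiv.Perm.sign σ * (Matrix.of fun i k => B i (κ i) k).det) := by
    intro σ
    have h := (Matrix.detRowAlternating (n := Fin n) (R := ℝ)).toMultilinearMap.map_sum
      (fun j (l : Fin (m (σ j))) => fun k => B (σ j) l j * B (σ j) l k)
    have h' : (Matrix.of fun j k => A (σ j) j k).det =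
      ∑ r : (∀ j, Fin (m (σ j))), Matrix.det
        (Matrix.of fun j k => B (σ j) (r j) j * B (σ j) (r j) k) := by
      refine Eq.trans ?_ h
      change Matrix.det _ = Matrix.det _
      congr 1
      ext j k
      simp [hA']
    rw [h']
    symm
    refine Fintype.sum_equiv (Equiv.piCongrLeft (fun i => Fin (m i)) σ).symm _ _ ?_
    intro κ
    rw [← Matrix.det_permute]
    rw [← Matrix.det_mul_column]
    congr 1
  rw [mdisc_eq_perm]
  simp_rw [h1]
  rw [Finset.sum_comm]
  refine Finset.sum_nonneg fun κ _ => ?_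
  have : ∑ σ : Equiv.Perm (Fin n), (∏ j, B (σ j) (κ (σ j)) j) *
        (Equiv.Perm.sign σ * (Matrix.of fun i k => B i (κ i) k).det) =
      (Matrix.of fun i k => B i (κ i) k).det * (Matrix.of fun i k => B i (κ i) k).det := by
    conv_rhs => enter [1]; rw [Matrix.det_apply']
    rw [Finset.sum_mul]
    refine Finset.sum_congr rfl fun σ _ => ?_
    simp only [Matrix.of_apply]
    ring
  rw [this]
  exact mul_self_nonneg _

end MixedDisc

section Pot
variable {n : ℕ}

abbrev Eu (n : ℕ) := EuclideanSpace ℝ (Fin n)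

noncomputable def bvec (i : Fin n) : Eu n := EuclideanSpace.single i (1 : ℝ)

/-- Riesz map in coordinates. -/
noncomputable def riesz (n : ℕ) : (Eu n →L[ℝ] ℝ) →L[ℝ] Eu n :=
  ((EuclideanSpace.equiv (Fin n) ℝ).symm : (Fin n → ℝ) →L[ℝ] Eu n) ∘L
    ContinuousLinearMap.pi (fun j => ContinuousLinearMap.apply ℝ ℝ (bvec j))

lemma riesz_apply (L : Eu n →L[ℝ] ℝ) (j : Fin n) : riesz n L j = L (bvec j) := by
  simp [riesz]

lemma clm_expand (L : Eu n →L[ℝ] ℝ) (v : Eu n) : L v = ∑ j, v j * L (bvec j) := by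
  have h : v = ∑ j, v j • bvec j := by
    have := (EuclideanSpace.basisFun (Fin n) ℝ).sum_repr v
    simpa [bvec] using this.symm
  conv_lhs => rw [h]
  simp

lemma inner_riesz (L : Eu n →L[ℝ] ℝ) (v : Eu n) : inner ℝ (riesz n L) v = L v := by
  rw [clm_expand L v, PiLp.inner_apply]
  simp [riesz_apply]

noncomputable def hess (φ : Eu n → ℝ) (x : Eu n) : Matrix (Fin n) (Fin n) ℝ :=
  Matrix.of fun i j => fderiv ℝ (fderiv ℝ φ) x (bvec i) (bvec j)

noncomputable def grd (φ : Eu n → ℝ) (x : Eu n) : Eu n := riesz n (fderiv ℝ φ x)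

lemma hasFDerivAt_fderiv {φ : Eu n → ℝ} (hφ : ContDiff ℝ 2 φ) (x : Eu n) :
    HasFDerivAt (fderiv ℝ φ) (fderiv ℝ (fderiv ℝ φ) x) x := by
  have h : ContDiff ℝ 1 (fderiv ℝ φ) := hφ.fderiv_right (by norm_num)
  exact (h.differentiable (by norm_num) x).hasFDerivAt

lemma hasFDerivAt_grd {φ : Eu n → ℝ} (hφ : ContDiff ℝ 2 φ) (x : Eu n) :
    HasFDerivAt (grd φ) ((riesz n) ∘L (fderiv ℝ (fderiv ℝ φ) x)) x :=
  (riesz n).hasFDerivAt.comp x (hasFDerivAt_fderiv hφ x)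

lemma det_grd (φ : Eu n → ℝ) (x : Eu n) :
    ((riesz n) ∘L (fderiv ℝ (fderiv ℝ φ) x)).det = (hess φ x).det := by
  rw [← Matrix.det_transpose]
  change LinearMap.det _ = _
  rw [← LinearMap.det_toMatrix (EuclideanSpace.basisFun (Fin n) ℝ).toBasis]
  congr 1

lemma hess_continuous {φ : Eu n → ℝ} (hφ : ContDiff ℝ 2 φ) : Continuous (hess φ) := by
  have h : ContDiff ℝ 1 (fderiv ℝ φ) := hφ.fderiv_right (by norm_num)
  have h2 : Continuous (fderiv ℝ (fderiv ℝ φ)) := h.continuous_fderiv (by norm_num)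
  refine continuous_matrix fun i j => ?_
  simp only [hess, Matrix.of_apply]
  fun_prop

lemma quad_hess (φ : Eu n → ℝ) (x : Eu n) (v : Eu n) :
    (v : Fin n → ℝ) ⬝ᵥ (hess φ x).mulVec v = fderiv ℝ (fderiv ℝ φ) x v v := by
  rw [clm_expand (fderiv ℝ (fderiv ℝ φ) x v) v]
  have : ∀ j, fderiv ℝ (fderiv ℝ φ) x v (bvec j) = ∑ i, v i * hess φ x i j := by
    intro j
    have := clm_expand ((ContinuousLinearMap.apply ℝ ℝ (bvec j)) ∘L (fderiv ℝ (fderiv ℝ φ) x)) v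
    simpa [hess] using this
  simp_rw [this]
  rw [Matrix.dotProduct_mulVec]
  simp only [dotProduct, Matrix.vecMul]
  refine Finset.sum_congr rfl fun j _ => ?_
  ring

/-- derivative along lines -/
lemma hasDerivAt_line {φ : Eu n → ℝ} (hφ : ContDiff ℝ 2 φ) (x v : Eu n) (s : ℝ) :
    HasDerivAt (fun s : ℝ => φ (x + s • v)) (fderiv ℝ φ (x + s • v) v) s := by
  have h1 : HasDerivAt (fun s : ℝ => x + s • v) v s := by
    simpa using ((hasDerivAt_id s).smul_const v).const_add x
  exact ((hφ.differentiable (by norm_num) _).hasFDerivAt).comp_hasDerivAt s h1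

lemma hasDerivAt_line2 {φ : Eu n → ℝ} (hφ : ContDiff ℝ 2 φ) (x v : Eu n) (s : ℝ) :
    HasDerivAt (fun s : ℝ => fderiv ℝ φ (x + s • v) v)
      (fderiv ℝ (fderiv ℝ φ) (x + s • v) v v) s := by
  have h1 : HasDerivAt (fun s : ℝ => x + s • v) v s := by
    simpa using ((hasDerivAt_id s).smul_const v).const_add x
  have h2 := (hasFDerivAt_fderiv hφ (x + s • v)).comp_hasDerivAt s h1
  exact ((ContinuousLinearMap.apply ℝ ℝ v).hasFDerivAt).comp_hasDerivAt s h2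

lemma convexOn_line {φ : Eu n → ℝ} (hc : ConvexOn ℝ Set.univ φ) (x v : Eu n) :
    ConvexOn ℝ Set.univ (fun s : ℝ => φ (x + s • v)) := by
  have := hc.comp_affineMap (AffineMap.lineMap x (x + v) : ℝ →ᵃ[ℝ] Eu n)
  have e : (φ ∘ (AffineMap.lineMap x (x + v) : ℝ →ᵃ[ℝ] Eu n)) = fun s : ℝ => φ (x + s • v) := by
    ext s; simp [AffineMap.lineMap_apply, add_comm]
  rw [e] at this
  simpa using this

lemma monotone_line {φ : Eu n → ℝ} (hφ : ContDiff ℝ 2 φ) (hc : ConvexOn ℝ Set.univ φ)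
    (x v : Eu n) : Monotone (fun s : ℝ => fderiv ℝ φ (x + s • v) v) := by
  have h := (convexOn_line hc x v).monotoneOn_deriv
    (fun s _ => (hasDerivAt_line hφ x v s).differentiableAt)
  intro a b hab
  have := h (Set.mem_univ a) (Set.mem_univ b) hab
  rwa [(hasDerivAt_line hφ x v a).deriv, (hasDerivAt_line hφ x v b).deriv] at this

lemma gradient_ineq {φ : Eu n → ℝ} (hφ : ContDiff ℝ 2 φ) (hc : ConvexOn ℝ Set.univ φ)
    (x v : Eu n) : φ x + fderiv ℝ φ x v ≤ φ (x + v) := by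
  have h := (convexOn_line hc x v).le_slope_of_hasDerivAt (Set.mem_univ 0) (Set.mem_univ 1)
    one_pos (hasDerivAt_line hφ x v 0)
  simp [slope_def_field] at h
  linarith

lemma hess_posSemidef {φ : Eu n → ℝ} (hφ : ContDiff ℝ 2 φ) (hc : ConvexOn ℝ Set.univ φ)
    (x : Eu n) : (hess φ x).PosSemidef := by
  refine Matrix.PosSemidef.of_dotProduct_mulVec_nonneg ?_ ?_
  · have hs : IsSymmSndFDerivAt ℝ φ x := hφ.contDiffAt.isSymmSndFDerivAt (by simp)
    ext i j
    simp only [hess, Matrix.conjTranspose_apply, Matrix.of_apply, star_trivial]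
    exact hs _ _
  · intro v
    have h := quad_hess φ x (WithLp.toLp 2 v)
    simp only [star_trivial] at h ⊢
    rw [show (v ⬝ᵥ (hess φ x).mulVec v) = _ from h]
    have h2 := hasDerivAt_line2 hφ x (WithLp.toLp 2 v) 0
    rw [zero_smul, add_zero] at h2
    rw [← h2.deriv]
    exact (monotone_line hφ hc x _).deriv_nonneg

lemma grd_inj {φ : Eu n → ℝ} (hφ : ContDiff ℝ 2 φ) (hc : ConvexOn ℝ Set.univ φ)
    {x y : Eu n} (hd : (hess φ x).det ≠ 0) (hxy : grd φ x = grd φ y) : x = y := by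
  by_contra hne
  set v := y - x with hv
  have hv0 : v ≠ 0 := sub_ne_zero.mpr (Ne.symm hne)
  have hm := monotone_line hφ hc x v
  have h01 : fderiv ℝ φ x v = fderiv ℝ φ y v := by
    rw [← inner_riesz, ← inner_riesz]
    exact congrArg (fun z => inner ℝ z v) hxy
  have hconst : ∀ s ∈ Set.Icc (0 : ℝ) 1, fderiv ℝ φ (x + s • v) v = fderiv ℝ φ x v := by
    intro s hs
    have h1 := hm hs.1
    have h2 := hm hs.2
    simp only [zero_smul, add_zero, one_smul] at h1 h2
    have : x + v = y := by simp [hv]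
    rw [this] at h2
    linarith
  have h2 := (hasDerivAt_line2 hφ x v 0).hasDerivWithinAt (s := Set.Icc 0 1)
  have h3 : HasDerivWithinAt (fun s : ℝ => fderiv ℝ φ (x + s • v) v) 0 (Set.Icc 0 1) 0 :=
    (hasDerivWithinAt_const (0 : ℝ) (Set.Icc (0 : ℝ) 1) (fderiv ℝ φ x v)).congr
      hconst (hconst 0 (by simp))
  have h4 := (uniqueDiffOn_Icc (zero_lt_one' ℝ) 0 (by simp)).eq_deriv _ h2 h3
  rw [zero_smul, add_zero, ← quad_hess] at h4
  have h5 := ((hess_posSemidef hφ hc x).dotProduct_mulVec_zero_iff (v : Fin n → ℝ)).mp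
    (by simpa using h4)
  exact hv0 (by
    have := Matrix.eq_zero_of_mulVec_eq_zero hd h5
    ext i; exact congrFun this i)

/-- `φ` is a smooth convex function at bounded distance from the support function of `K`. -/
structure IsPot (K : Set (Eu n)) (φ : Eu n → ℝ) : Prop where
  contDiff : ContDiff ℝ 2 φ
  convex : ConvexOn ℝ Set.univ φ
  lower : ∃ C, ∀ x, ∀ y ∈ K, inner ℝ x y ≤ φ x + C
  upper : ∃ C, ∀ x, ∃ y ∈ K, φ x ≤ inner ℝ x y + C

lemma IsPot.range_subset {K : Set (Eu n)} {φ : Eu n → ℝ} (h : IsPot K φ) (hK : Convex ℝ K)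
    (hKc : IsCompact K) : Set.range (grd φ) ⊆ K := by
  rintro _ ⟨x, rfl⟩
  by_contra hp
  obtain ⟨f, s, h1, h2⟩ := geometric_hahn_banach_closed_point hK hKc.isClosed hp
  obtain ⟨M, hM⟩ := hKc.isBounded.exists_norm_le
  obtain ⟨C, hC⟩ := h.upper
  set u := riesz n f with hu
  have hfu : ∀ z, f z = inner ℝ u z := fun z => (inner_riesz f z).symm
  -- along x + t u
  have key : ∀ t : ℝ, 0 ≤ t → t * (inner ℝ u (grd φ x) - s) ≤ ‖x‖ * M + C - φ x := by
    intro t ht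
    have g1 := gradient_ineq h.contDiff h.convex x (t • u)
    obtain ⟨y, hy, g2⟩ := hC (x + t • u)
    rw [inner_add_left, inner_smul_left] at g2
    have g3 : inner ℝ x y ≤ ‖x‖ * M :=
      (real_inner_le_norm x y).trans (mul_le_mul_of_nonneg_left (hM y hy) (norm_nonneg _))
    have g4 := (h1 y hy).le
    rw [hfu] at g4
    have g5 : fderiv ℝ φ x (t • u) = t * inner ℝ u (grd φ x) := by
      rw [map_smul, smul_eq_mul, grd, real_inner_comm, inner_riesz]
    have g6 := mul_le_mul_of_nonneg_left g4 ht
    simp at g2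
    nlinarith
  have hpos : 0 < inner ℝ u (grd φ x) - s := by rw [← hfu]; linarith
  have := key ((|‖x‖ * M + C - φ x| + 1) / (inner ℝ u (grd φ x) - s)) (by positivity)
  rw [div_mul_cancel₀ _ hpos.ne'] at this
  have := le_abs_self (‖x‖ * M + C - φ x)
  linarith

lemma IsPot.interior_subset {K : Set (Eu n)} {φ : Eu n → ℝ} (h : IsPot K φ) :
    interior K ⊆ Set.range (grd φ) := by
  intro p hp
  obtain ⟨ε, hε, hb⟩ := Metric.nhds_basis_closedBall.mem_iff.mp (mem_interior_iff_mem_nhds.mp hp)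
  obtain ⟨C, hC⟩ := h.lower
  set ψ : Eu n → ℝ := fun x => φ x - inner ℝ p x with hψ
  have hlow : ∀ x, ε * ‖x‖ - C ≤ ψ x := by
    intro x
    by_cases hx : x = 0
    · have := hC 0 p (hb (Metric.mem_closedBall_self hε.le))
      simp [hψ, hx] at this ⊢; linarith
    · have hx' : ‖x‖ ≠ 0 := norm_ne_zero_iff.mpr hx
      have := hC x (p + (ε / ‖x‖) • x) (hb (by
        simp [norm_smul, abs_of_pos hε, hx']))
      rw [inner_add_right, inner_smul_right, real_inner_self_eq_norm_sq] at this
      have e : ε / ‖x‖ * ‖x‖ ^ 2 = ε * ‖x‖ := by field_simp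
      rw [e, real_inner_comm] at this
      simp only [hψ]; linarith
  have hφd : Differentiable ℝ φ := h.contDiff.differentiable (by norm_num)
  have hcont : Continuous ψ := by
    have := h.contDiff.continuous
    fun_prop
  have htend : Filter.Tendsto ψ (Filter.cocompact _) Filter.atTop := by
    refine Filter.tendsto_atTop_mono hlow ?_
    refine Filter.tendsto_atTop_add_const_right _ (-C) ?_
    exact (tendsto_norm_cocompact_atTop).const_mul_atTop hε
  obtain ⟨x, hx⟩ := hcont.exists_forall_le htend
  have hmin : IsLocalMin ψ x := Filter.Eventually.of_forall hx
  have hfd := hmin.fderiv_eq_zero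
  have hd : HasFDerivAt ψ (fderiv ℝ φ x - innerSL ℝ p) x :=
    (hφd x).hasFDerivAt.sub (innerSL ℝ p).hasFDerivAt
  rw [hd.fderiv, sub_eq_zero] at hfd
  refine ⟨x, ?_⟩
  refine ext_inner_right ℝ fun v => ?_
  rw [grd, inner_riesz, hfd]; simp

lemma IsPot.volume_eq {K : Set (Eu n)} {φ : Eu n → ℝ} (h : IsPot K φ) (hK : Convex ℝ K)
    (hKc : IsCompact K) : volume K = ∫⁻ x, ENNReal.ofReal (hess φ x).det := by
  have hr : volume K = volume (Set.range (grd φ)) := by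
    apply le_antisymm
    · calc volume K ≤ volume (interior K ∪ frontier K) := by
            refine measure_mono ?_
            rw [← closure_eq_interior_union_frontier]; exact subset_closure
        _ ≤ volume (interior K) + volume (frontier K) := measure_union_le _ _
        _ = volume (interior K) := by rw [hK.addHaar_frontier volume, add_zero]
        _ ≤ _ := measure_mono h.interior_subset
    · exact measure_mono (h.range_subset hK hKc)
  have hcd : Continuous fun x => (hess φ x).det := (hess_continuous h.contDiff).matrix_det
  set s : Set (Eu n) := {x | (hess φ x).det ≠ 0} with hs
  have hsm : MeasurableSet s := (isOpen_ne_fun hcd continuous_const).measurableSet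
  have h1 : volume (grd φ '' sᶜ) = 0 := by
    refine addHaar_image_eq_zero_of_det_fderivWithin_eq_zero volume
      (fun x _ => (hasFDerivAt_grd h.contDiff x).hasFDerivWithinAt) ?_
    intro x hx
    rw [det_grd]
    simpa [hs] using hx
  have h2 : ∫⁻ x in s, ENNReal.ofReal |(hess φ x).det| = volume (grd φ '' s) := by
    have := lintegral_abs_det_fderiv_eq_addHaar_image volume hsm
      (fun x _ => (hasFDerivAt_grd h.contDiff x).hasFDerivWithinAt)
      (fun x hx y _ hxy => grd_inj h.contDiff h.convex hx hxy)
    simpa only [det_grd] using this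
  have h3 : volume (Set.range (grd φ)) = volume (grd φ '' s) := by
    apply le_antisymm
    · rw [← Set.image_univ, ← Set.union_compl_self s, Set.image_union]
      refine (measure_union_le _ _).trans ?_
      rw [h1, add_zero]
    · exact measure_mono (Set.image_subset_range _ _)
  have habs : ∀ x, |(hess φ x).det| = (hess φ x).det := fun x =>
    abs_of_nonneg (hess_posSemidef h.contDiff h.convex x).det_nonneg
  rw [hr, h3, ← h2]
  simp only [habs]
  rw [← lintegral_indicator hsm]
  refine lintegral_congr fun x => ?_
  by_cases hx : x ∈ s
  · simp [hx]
  · have : (hess φ x).det = 0 := by simpa [hs] using hx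
    simp [hx, this]

lemma IsPot.integrable {K : Set (Eu n)} {φ : Eu n → ℝ} (h : IsPot K φ) (hK : Convex ℝ K)
    (hKc : IsCompact K) : Integrable (fun x => (hess φ x).det) := by
  have hcd : Continuous fun x => (hess φ x).det := (hess_continuous h.contDiff).matrix_det
  refine ⟨hcd.aestronglyMeasurable, ?_⟩
  rw [hasFiniteIntegral_iff_ofReal (Filter.Eventually.of_forall fun x =>
    (hess_posSemidef h.contDiff h.convex x).det_nonneg), ← h.volume_eq hK hKc]
  exact hKc.measure_lt_top

lemma IsPot.volume_toReal {K : Set (Eu n)} {φ : Eu n → ℝ} (h : IsPot K φ) (hK : Convex ℝ K)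
    (hKc : IsCompact K) : (volume K).toReal = ∫ x, (hess φ x).det := by
  rw [integral_eq_lintegral_of_nonneg_ae (Filter.Eventually.of_forall fun x =>
    (hess_posSemidef h.contDiff h.convex x).det_nonneg) (h.integrable hK hKc).1,
    ← h.volume_eq hK hKc]

end Pot

section Moll
variable {n : ℕ}

noncomputable def bmp (n : ℕ) : ContDiffBump (0 : Eu n) := ⟨1 / 2, 1, by norm_num, by norm_num⟩

noncomputable def rho (n : ℕ) : Eu n → ℝ := (bmp n).normed volume

noncomputable def moll (f : Eu n → ℝ) (x : Eu n) : ℝ := ∫ y, rho n y * f (x - y)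

lemma rho_eq_zero {y : Eu n} (hy : 1 ≤ ‖y‖) : rho n y = 0 := by
  have : y ∉ Function.support (rho n) := by
    rw [rho, ContDiffBump.support_normed_eq]
    simpa [bmp] using hy
  simpa using this

lemma rho_nonneg (y : Eu n) : 0 ≤ rho n y := (bmp n).nonneg_normed y

lemma rho_integrable {f : Eu n → ℝ} (hf : Continuous f) (x : Eu n) :
    Integrable (fun y => rho n y * f (x - y)) := by
  have hc : Continuous (rho n) := (bmp n).continuous_normed
  refine Continuous.integrable_of_hasCompactSupport (by fun_prop) ?_
  exact HasCompactSupport.mul_right (bmp n).hasCompactSupport_normed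

lemma moll_const (c : ℝ) : ∫ y, rho n y * c = c := by
  rw [integral_mul_const, rho, ContDiffBump.integral_normed, one_mul]

lemma moll_contDiff {f : Eu n → ℝ} (hf : Continuous f) : ContDiff ℝ 2 (moll f) := by
  have h := HasCompactSupport.contDiff_convolution_left (n := 2) (μ := (volume : Measure (Eu n)))
    (ContinuousLinearMap.lsmul ℝ ℝ) (bmp n).hasCompactSupport_normed
    ((bmp n).contDiff_normed (μ := volume)) hf.locallyIntegrable
  exact h

lemma moll_convex {f : Eu n → ℝ} (hf : Continuous f) (hc : ConvexOn ℝ Set.univ f) :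
    ConvexOn ℝ Set.univ (moll f) := by
  refine ⟨convex_univ, fun x _ x' _ a b ha hb hab => ?_⟩
  have e : a • moll f x + b • moll f x' =
      ∫ y, (a * (rho n y * f (x - y)) + b * (rho n y * f (x' - y))) := by
    rw [integral_add ((rho_integrable hf x).const_mul a) ((rho_integrable hf x').const_mul b),
      integral_const_mul, integral_const_mul]
    rfl
  rw [e]
  refine integral_mono (rho_integrable hf _)
    (((rho_integrable hf x).const_mul a).add ((rho_integrable hf x').const_mul b)) fun y => ?_
  have h := hc.2 (Set.mem_univ (x - y)) (Set.mem_univ (x' - y)) ha hb hab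
  have e2 : a • (x - y) + b • (x' - y) = a • x + b • x' - y := by
    have : y = (a + b) • y := by rw [hab, one_smul]
    conv_rhs => rw [this]
    module
  rw [e2] at h
  have := mul_le_mul_of_nonneg_left h (rho_nonneg y)
  simp only [smul_eq_mul] at this ⊢
  linarith

lemma moll_congr {f g : Eu n → ℝ} {c : ℝ} {x : Eu n} (hf : Continuous f)
    (h : ∀ y, ‖y‖ < 1 → g (x - y) = f (x - y) + c) : moll g x = moll f x + c := by
  calc moll g x = ∫ y, (rho n y * f (x - y) + rho n y * c) := by
        refine integral_congr_ae (Filter.Eventually.of_forall fun y => ?_)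
        by_cases hy : ‖y‖ < 1
        · simp only [h y hy]; ring
        · simp [rho_eq_zero (not_lt.mp hy)]
    _ = _ := by
        rw [integral_add (rho_integrable hf x), moll_const]; rfl
        exact ((bmp n).integrable_normed).mul_const c

lemma moll_dist {f : Eu n → ℝ} {M : NNReal} (hf : LipschitzWith M f) (x : Eu n) :
    |moll f x - f x| ≤ M := by
  have h := (bmp n).dist_normed_convolution_le (μ := volume) (x₀ := x) (ε := M) (g := f)
    hf.continuous.aestronglyMeasurable (fun y hy => by
      refine (hf.dist_le_mul y x).trans ?_
      have : dist y x ≤ 1 := by simpa [bmp] using (Metric.mem_ball.mp hy).le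
      exact mul_le_of_le_one_right M.2 this)
  exact h

lemma moll_isPot {K : Set (Eu n)} {f : Eu n → ℝ} {M : NNReal} (hf : LipschitzWith M f)
    (hc : ConvexOn ℝ Set.univ f) (hl : ∃ C, ∀ x, ∀ y ∈ K, inner ℝ x y ≤ f x + C)
    (hu : ∃ C, ∀ x, ∃ y ∈ K, f x ≤ inner ℝ x y + C) : IsPot K (moll f) := by
  refine ⟨moll_contDiff hf.continuous, moll_convex hf.continuous hc, ?_, ?_⟩
  · obtain ⟨C, hC⟩ := hl
    refine ⟨C + M, fun x y hy => ?_⟩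
    have := hC x y hy
    have := abs_le.mp (moll_dist hf x)
    linarith [this.1]
  · obtain ⟨C, hC⟩ := hu
    refine ⟨C + M, fun x => ?_⟩
    obtain ⟨y, hy, h⟩ := hC x
    have := abs_le.mp (moll_dist hf x)
    exact ⟨y, hy, by linarith [this.2]⟩

/-- nonempty compact convex sets -/
def CC (K : Set (Eu n)) : Prop := Convex ℝ K ∧ IsCompact K ∧ K.Nonempty

noncomputable def supp (K : Set (Eu n)) (x : Eu n) : ℝ := sSup ((fun y => inner ℝ x y) '' K)

lemma exists_supp {K : Set (Eu n)} (hK : CC K) (x : Eu n) :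
    ∃ y ∈ K, supp K x = inner ℝ x y := by
  have hc : ContinuousOn (fun y : Eu n => inner ℝ x y) K := by fun_prop
  obtain ⟨y, hy, h, _⟩ := hK.2.1.exists_sSup_image_eq_and_ge hK.2.2 hc
  exact ⟨y, hy, h⟩

lemma le_supp {K : Set (Eu n)} (hK : CC K) (x : Eu n) {y : Eu n} (hy : y ∈ K) :
    inner ℝ x y ≤ supp K x := by
  have hc : Continuous (fun y : Eu n => inner ℝ x y) := by fun_prop
  exact le_csSup (hK.2.1.image hc).bddAbove ⟨y, hy, rfl⟩

lemma supp_convex {K : Set (Eu n)} (hK : CC K) : ConvexOn ℝ Set.univ (supp K) := by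
  refine ⟨convex_univ, fun x _ x' _ a b ha hb _ => ?_⟩
  obtain ⟨y, hy, h⟩ := exists_supp hK (a • x + b • x')
  rw [h, inner_add_left, inner_smul_left, inner_smul_left]
  have h1 := mul_le_mul_of_nonneg_left (le_supp hK x hy) ha
  have h2 := mul_le_mul_of_nonneg_left (le_supp hK x' hy) hb
  simp only [smul_eq_mul]
  simpa using add_le_add h1 h2

lemma supp_lip {K : Set (Eu n)} (hK : CC K) {M : NNReal} (hM : ∀ y ∈ K, ‖y‖ ≤ M) :
    LipschitzWith M (supp K) := by
  refine LipschitzWith.of_le_add_mul _ fun x x' => ?_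
  obtain ⟨y, hy, h⟩ := exists_supp hK x
  have h1 := le_supp hK x' hy
  have h2 : inner ℝ (x - x') y ≤ M * dist x x' := by
    refine (real_inner_le_norm _ _).trans ?_
    rw [mul_comm, dist_eq_norm]
    exact mul_le_mul_of_nonneg_right (hM y hy) (norm_nonneg _)
  rw [inner_sub_left] at h2
  linarith

lemma CC.exists_bound {K : Set (Eu n)} (hK : CC K) : ∃ M : NNReal, ∀ y ∈ K, ‖y‖ ≤ M := by
  obtain ⟨M, hM⟩ := hK.2.1.isBounded.exists_norm_le
  exact ⟨M.toNNReal, fun y hy => (hM y hy).trans (Real.le_coe_toNNReal M)⟩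

lemma supp_isPot {K : Set (Eu n)} (hK : CC K) : IsPot K (moll (supp K)) := by
  obtain ⟨M, hM⟩ := hK.exists_bound
  refine moll_isPot (supp_lip hK hM) (supp_convex hK) ⟨0, fun x y hy => ?_⟩ ⟨0, fun x => ?_⟩
  · simpa using le_supp hK x hy
  · obtain ⟨y, hy, h⟩ := exists_supp hK x
    exact ⟨y, hy, by simp [h]⟩

lemma hess_congr {φ ψ : Eu n → ℝ} {x : Eu n} (h : φ =ᶠ[nhds x] ψ) : hess φ x = hess ψ x := by
  unfold hess
  rw [h.fderiv.fderiv_eq]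

lemma hess_add_const (φ : Eu n → ℝ) (c : ℝ) (x : Eu n) :
    hess (fun y => φ y + c) x = hess φ x := by
  unfold hess
  have : fderiv ℝ (fun y => φ y + c) = fderiv ℝ φ := by
    ext1 y; exact fderiv_add_const c
  rw [this]

lemma exists_glue {K L : Set (Eu n)} (hK : CC K) (hL : CC L) (hKL : K ⊆ L) (R : ℝ) :
    ∃ φ, IsPot L φ ∧ ∀ x ∈ Metric.ball (0 : Eu n) R, hess φ x = hess (moll (supp K)) x := by
  obtain ⟨M, hM⟩ := hL.exists_bound
  set c : ℝ := 2 * M * (|R| + 1) with hc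
  have hc0 : 0 ≤ c := by positivity
  have hKlip := supp_lip hK (fun y hy => hM y (hKL hy))
  have hLlip := supp_lip hL hM
  set g : Eu n → ℝ := fun x => max (supp K x + c) (supp L x) with hg
  have hKl : ∀ x, supp K x ≤ supp L x := by
    intro x
    obtain ⟨y, hy, h⟩ := exists_supp hK x
    rw [h]; exact le_supp hL x (hKL hy)
  have hglip : LipschitzWith (max M M) g := by
    refine LipschitzWith.max ?_ hLlip
    exact LipschitzWith.of_le_add_mul _ fun x y => by
      have := hKlip.le_add_mul x y; linarith
  have hgc : ConvexOn ℝ Set.univ g :=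
    ((supp_convex hK).add (convexOn_const c convex_univ)).sup (supp_convex hL)
  refine ⟨moll g, moll_isPot hglip hgc ⟨0, fun x y hy => ?_⟩ ⟨c, fun x => ?_⟩, fun x hx => ?_⟩
  · rw [add_zero]; exact (le_supp hL x hy).trans (le_max_right _ _)
  · obtain ⟨y, hy, h⟩ := exists_supp hL x
    refine ⟨y, hy, ?_⟩
    rw [← h]
    exact max_le (by linarith [hKl x]) (by linarith)
  · have : moll g =ᶠ[nhds x] fun z => moll (supp K) z + c := by
      filter_upwards [Metric.isOpen_ball.mem_nhds hx] with z hz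
      refine moll_congr hKlip.continuous fun y hy => ?_
      refine max_eq_left ?_
      have hzy : ‖z - y‖ ≤ |R| + 1 := by
        have h1 := norm_sub_le z y
        have h2 : ‖z‖ < R := by simpa using hz
        linarith [le_abs_self R]
      obtain ⟨p, hp, h⟩ := exists_supp hL (z - y)
      obtain ⟨q, hq⟩ := hK.2.2
      have h3 := le_supp hK (z - y) hq
      have h4 : inner ℝ (z - y) p ≤ (|R| + 1) * M :=
        (real_inner_le_norm _ _).trans (mul_le_mul hzy (hM p hp) (norm_nonneg _) (by positivity))
      have h5 : -inner ℝ (z - y) q ≤ (|R| + 1) * M := by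
        rw [← inner_neg_right]
        refine (real_inner_le_norm _ _).trans ?_
        rw [norm_neg]
        exact mul_le_mul hzy (hM q (hKL hq)) (norm_nonneg _) (by positivity)
      rw [h, hc]; linarith
    rw [hess_congr this, hess_add_const]

end Moll

section MV
variable {n : ℕ}

lemma CC.add {K L : Set (Eu n)} (hK : CC K) (hL : CC L) : CC (K + L) :=
  ⟨hK.1.add hL.1, hK.2.1.add hL.2.1, hK.2.2.add hL.2.2⟩

lemma CC.smul {K : Set (Eu n)} (hK : CC K) (c : ℝ) : CC (c • K) :=
  ⟨hK.1.smul c, hK.2.1.smul c, hK.2.2.smul_set⟩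

lemma CC.zero : CC (0 : Set (Eu n)) :=
  ⟨convex_singleton 0, isCompact_singleton, Set.singleton_nonempty 0⟩

lemma CC.singleton (x : Eu n) : CC ({x} : Set (Eu n)) :=
  ⟨convex_singleton x, isCompact_singleton, Set.singleton_nonempty x⟩

lemma CC.sum {ι : Type*} (S : Finset ι) {K : ι → Set (Eu n)} (hK : ∀ i, CC (K i)) :
    CC (∑ i ∈ S, K i) := by
  classical
  induction S using Finset.induction_on with
  | empty => simpa using CC.zero
  | insert a S ha ih => rw [Finset.sum_insert ha]; exact (hK a).add ih

lemma IsPot.add {K L : Set (Eu n)} {φ ψ : Eu n → ℝ} (hφ : IsPot K φ) (hψ : IsPot L ψ) :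
    IsPot (K + L) (φ + ψ) := by
  refine ⟨hφ.contDiff.add hψ.contDiff, hφ.convex.add hψ.convex, ?_, ?_⟩
  · obtain ⟨C, hC⟩ := hφ.lower
    obtain ⟨C', hC'⟩ := hψ.lower
    refine ⟨C + C', ?_⟩
    rintro x _ ⟨y, hy, z, hz, rfl⟩
    have := hC x y hy
    have := hC' x z hz
    simp only [inner_add_right, Pi.add_apply]; linarith
  · obtain ⟨C, hC⟩ := hφ.upper
    obtain ⟨C', hC'⟩ := hψ.upper
    refine ⟨C + C', fun x => ?_⟩
    obtain ⟨y, hy, h1⟩ := hC x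
    obtain ⟨z, hz, h2⟩ := hC' x
    refine ⟨y + z, Set.add_mem_add hy hz, ?_⟩
    simp only [inner_add_right, Pi.add_apply]; linarith

lemma IsPot.smul {K : Set (Eu n)} {φ : Eu n → ℝ} (hφ : IsPot K φ) {c : ℝ} (hc : 0 ≤ c) :
    IsPot (c • K) (c • φ) := by
  refine ⟨contDiff_const.smul hφ.contDiff, hφ.convex.smul hc, ?_, ?_⟩
  · obtain ⟨C, hC⟩ := hφ.lower
    refine ⟨c * C, ?_⟩
    rintro x _ ⟨y, hy, rfl⟩
    have := mul_le_mul_of_nonneg_left (hC x y hy) hc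
    simp only [inner_smul_right, Pi.smul_apply, smul_eq_mul]; linarith
  · obtain ⟨C, hC⟩ := hφ.upper
    refine ⟨c * C, fun x => ?_⟩
    obtain ⟨y, hy, h1⟩ := hC x
    refine ⟨c • y, Set.smul_mem_smul_set hy, ?_⟩
    have := mul_le_mul_of_nonneg_left h1 hc
    simp only [inner_smul_right, Pi.smul_apply, smul_eq_mul]; linarith

lemma IsPot.zero : IsPot (0 : Set (Eu n)) (0 : Eu n → ℝ) := by
  refine ⟨contDiff_const, convexOn_const 0 convex_univ, ⟨0, ?_⟩, ⟨0, fun x => ⟨0, rfl, by simp⟩⟩⟩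
  rintro x y hy
  have : y = 0 := hy
  simp [this]

lemma IsPot.sum {ι : Type*} (S : Finset ι) {K : ι → Set (Eu n)} {φ : ι → Eu n → ℝ}
    (h : ∀ i, IsPot (K i) (φ i)) : IsPot (∑ i ∈ S, K i) (∑ i ∈ S, φ i) := by
  classical
  induction S using Finset.induction_on with
  | empty => simpa using IsPot.zero
  | insert a S ha ih =>
    rw [Finset.sum_insert ha, Finset.sum_insert ha]; exact (h a).add ih

lemma hess_add {φ ψ : Eu n → ℝ} (hφ : ContDiff ℝ 2 φ) (hψ : ContDiff ℝ 2 ψ) (x : Eu n) :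
    hess (φ + ψ) x = hess φ x + hess ψ x := by
  have e : fderiv ℝ (φ + ψ) = fderiv ℝ φ + fderiv ℝ ψ := by
    ext1 y
    exact fderiv_add (hφ.differentiable (by norm_num) y) (hψ.differentiable (by norm_num) y)
  ext i j
  simp only [hess, e, Matrix.add_apply, Matrix.of_apply]
  rw [((hasFDerivAt_fderiv hφ x).add (hasFDerivAt_fderiv hψ x)).fderiv]
  simp

lemma hess_smul {φ : Eu n → ℝ} (hφ : ContDiff ℝ 2 φ) (c : ℝ) (x : Eu n) :
    hess (c • φ) x = c • hess φ x := by
  have e : fderiv ℝ (c • φ) = c • fderiv ℝ φ := by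
    ext1 y
    exact fderiv_const_smul (hφ.differentiable (by norm_num) y) c
  ext i j
  simp only [hess, e, Matrix.smul_apply, Matrix.of_apply]
  rw [((hasFDerivAt_fderiv hφ x).const_smul c).fderiv]
  simp

lemma hess_zero (x : Eu n) : hess (0 : Eu n → ℝ) x = 0 := by
  have := hess_smul (φ := (0 : Eu n → ℝ)) contDiff_const 0 x
  simpa using this

lemma hess_sum {ι : Type*} (S : Finset ι) {φ : ι → Eu n → ℝ} (h : ∀ i, ContDiff ℝ 2 (φ i))
    (x : Eu n) : hess (∑ i ∈ S, φ i) x = ∑ i ∈ S, hess (φ i) x := by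
  classical
  induction S using Finset.induction_on with
  | empty => simpa using hess_zero x
  | insert a S ha ih =>
    rw [Finset.sum_insert ha, Finset.sum_insert ha, hess_add (h a), ih]
    have : (∑ i ∈ S, φ i) = fun y => ∑ i ∈ S, φ i y := by ext y; simp
    rw [this]
    exact ContDiff.sum fun i _ => h i

lemma mdisc_integrable {K : Fin n → Set (Eu n)} {φ : Fin n → Eu n → ℝ}
    (hK : ∀ i, CC (K i)) (h : ∀ i, IsPot (K i) (φ i)) :
    Integrable (fun x => mdisc fun i => hess (φ i) x) := by
  unfold mdisc
  refine integrable_finsetSum _ fun S _ => ?_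
  refine Integrable.const_mul ?_ _
  have := (IsPot.sum S h).integrable (CC.sum S hK).1 (CC.sum S hK).2.1
  simpa only [hess_sum S fun i => (h i).contDiff] using this

lemma mv_eq {K : Fin n → Set (Eu n)} {φ : Fin n → Eu n → ℝ}
    (hK : ∀ i, CC (K i)) (h : ∀ i, IsPot (K i) (φ i)) :
    mixedVolume K = ((n.factorial : ℝ))⁻¹ * ∫ x, mdisc fun i => hess (φ i) x := by
  unfold mixedVolume mdisc
  have hi : ∀ S : Finset (Fin n), Integrable (fun x => (∑ i ∈ S, hess (φ i) x).det) := by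
    intro S
    have := (IsPot.sum S h).integrable (CC.sum S hK).1 (CC.sum S hK).2.1
    simpa only [hess_sum S fun i => (h i).contDiff] using this
  rw [integral_finsetSum _ fun S _ => (hi S).const_mul _]
  congr 1
  refine Finset.sum_congr rfl fun S _ => ?_
  rw [integral_const_mul, (IsPot.sum S h).volume_toReal (CC.sum S hK).1 (CC.sum S hK).2.1]
  simp only [hess_sum S fun i => (h i).contDiff]

lemma mv_mono {K L : Fin n → Set (Eu n)} (hK : ∀ i, CC (K i)) (hL : ∀ i, CC (L i))
    (hKL : ∀ i, K i ⊆ L i) : mixedVolume K ≤ mixedVolume L := by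
  have hp := fun i => supp_isPot (hK i)
  have hmint := mdisc_integrable hK hp
  rw [mv_eq hK hp]
  have hfac : (0 : ℝ) < n.factorial := by exact_mod_cast n.factorial_pos
  rw [inv_mul_le_iff₀ hfac]
  have ht : Filter.Tendsto (fun N : ℕ => ∫ x in Metric.ball (0 : Eu n) N,
      mdisc fun i => hess (moll (supp (K i))) x) Filter.atTop
      (nhds (∫ x, mdisc fun i => hess (moll (supp (K i))) x)) := by
    have := tendsto_setIntegral_of_monotone (μ := volume)
      (f := fun x => mdisc fun i => hess (moll (supp (K i))) x)
      (s := fun N : ℕ => Metric.ball (0 : Eu n) N) (fun N => Metric.isOpen_ball.measurableSet)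
      (fun a b hab => Metric.ball_subset_ball (by exact_mod_cast hab)) hmint.integrableOn
    rwa [Metric.iUnion_ball_nat, setIntegral_univ] at this
  refine le_of_tendsto' ht fun N => ?_
  choose θ hθ hθ' using fun i => exists_glue (hK i) (hL i) (hKL i) (N : ℝ)
  have hmintθ := mdisc_integrable hL hθ
  have hnn : ∀ x, 0 ≤ mdisc fun i => hess (θ i) x := fun x =>
    mdisc_nonneg _ fun i => hess_posSemidef (hθ i).contDiff (hθ i).convex x
  rw [mv_eq hL hθ, mul_inv_cancel_left₀ hfac.ne']
  calc _ = ∫ x in Metric.ball (0 : Eu n) N, mdisc fun i => hess (θ i) x := by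
        refine setIntegral_congr_fun Metric.isOpen_ball.measurableSet fun x hx => ?_
        simp only [hθ' _ x hx]
    _ ≤ _ := setIntegral_le_integral hmintθ (Filter.Eventually.of_forall hnn)

lemma mv_smul {K : Fin n → Set (Eu n)} (hK : ∀ i, CC (K i)) {c : Fin n → ℝ} (hc : ∀ i, 0 ≤ c i) :
    mixedVolume (fun i => c i • K i) = (∏ i, c i) * mixedVolume K := by
  have hp := fun i => supp_isPot (hK i)
  rw [mv_eq (fun i => (hK i).smul (c i)) (fun i => (hp i).smul (hc i)), mv_eq hK hp]
  simp only [hess_smul (hp _).contDiff, mdisc_smul]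
  rw [integral_const_mul]
  ring

lemma mv_update_add {K : Fin n → Set (Eu n)} (hK : ∀ i, CC (K i)) (i : Fin n)
    {P Q : Set (Eu n)} (hP : CC P) (hQ : CC Q) :
    mixedVolume (Function.update K i (P + Q)) =
      mixedVolume (Function.update K i P) + mixedVolume (Function.update K i Q) := by
  have hCC : ∀ {X : Set (Eu n)}, CC X → ∀ j, CC (Function.update K i X j) := by
    intro X hX j
    by_cases h : j = i
    · subst h; simpa using hX
    · simpa [h] using hK j
  have hpp : ∀ {X : Set (Eu n)} {ψ : Eu n → ℝ}, IsPot X ψ →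
      ∀ j, IsPot (Function.update K i X j)
        (Function.update (fun j => moll (supp (K j))) i ψ j) := by
    intro X ψ hX j
    by_cases h : j = i
    · subst h; simpa using hX
    · simpa [h] using supp_isPot (hK j)
  have hPp := supp_isPot hP
  have hQp := supp_isPot hQ
  have e : ∀ (ψ : Eu n → ℝ) x, (fun j => hess (Function.update (fun j => moll (supp (K j))) i ψ j) x)
      = Function.update (fun j => hess (moll (supp (K j))) x) i (hess ψ x) := by
    intro ψ x; ext1 j
    by_cases h : j = i
    · subst h; simp
    · simp [h]
  have i1 := mdisc_integrable (hCC hP) (hpp hPp)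
  have i2 := mdisc_integrable (hCC hQ) (hpp hQp)
  rw [mv_eq (hCC (hP.add hQ)) (hpp (hPp.add hQp)), mv_eq (hCC hP) (hpp hPp),
    mv_eq (hCC hQ) (hpp hQp), ← mul_add, ← integral_add i1 i2]
  congr 2
  ext1 x
  rw [e, e, e, hess_add hPp.contDiff hQp.contDiff, mdisc_update_add]

lemma mv_const {K : Set (Eu n)} (hK : CC K) :
    mixedVolume (fun _ : Fin n => K) = (volume K).toReal := by
  have hp := supp_isPot hK
  rw [mv_eq (fun _ => hK) (fun _ => hp), hp.volume_toReal hK.1 hK.2.1]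
  simp only [mdisc_const]
  have hfac : (n.factorial : ℝ) ≠ 0 := by exact_mod_cast n.factorial_ne_zero
  rw [integral_const_mul, inv_mul_cancel_left₀ hfac]

lemma mv_translate (K : Fin n → Set (Eu n)) (x : Fin n → Eu n) :
    mixedVolume (fun i => K i + {x i}) = mixedVolume K := by
  unfold mixedVolume
  congr 1
  refine Finset.sum_congr rfl fun S _ => ?_
  have h : ∑ i ∈ S, ({x i} : Set (Eu n)) = {∑ i ∈ S, x i} := by
    classical
    induction S using Finset.induction_on with
    | empty => simp; rfl
    | insert a S ha ih => simp [Finset.sum_insert ha, ih]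
  rw [Finset.sum_add_distrib, h]
  simp [Set.add_singleton, Set.image_add_right]

end MV

section Simplex
variable {n : ℕ}

lemma CC_simplex (b : AffineBasis (Fin (n + 1)) ℝ (Eu n)) : CC (convexHull ℝ (Set.range b)) :=
  ⟨convex_convexHull _ _, (Set.finite_range b).isCompact_convexHull ℝ,
    (Set.range_nonempty b).convexHull⟩

lemma mem_simplex (b : AffineBasis (Fin (n + 1)) ℝ (Eu n)) (z : Eu n) :
    z ∈ convexHull ℝ (Set.range b) ↔ ∀ i, 0 ≤ b.coord i z := by
  rw [b.convexHull_eq_nonneg_coord]; rfl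

lemma coord_add (b : AffineBasis (Fin (n + 1)) ℝ (Eu n)) (j : Fin (n + 1)) (z w : Eu n) :
    b.coord j (z + w) = b.coord j z + (b.coord j).linear w := by
  have := (b.coord j).map_vadd z w
  simpa [add_comm] using this

lemma coord_linear_sub (b : AffineBasis (Fin (n + 1)) ℝ (Eu n)) (j k l : Fin (n + 1)) :
    (b.coord j).linear (b k - b l) = (if j = k then 1 else 0) - (if j = l then 1 else 0) := by
  have := (b.coord j).linearMap_vsub (b k) (b l)
  simpa [b.coord_apply] using this

/-- The part of a simplex close to two facets has volume `O(t ^ 2)`. -/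
lemma corner_bound (hn : 2 ≤ n) (b : AffineBasis (Fin (n + 1)) ℝ (Eu n)) :
    ∃ C : ℝ, 0 ≤ C ∧ ∀ N : ℕ, 0 < N → ∀ j k : Fin (n + 1), j ≠ k →
      volume {z | z ∈ convexHull ℝ (Set.range b) ∧ b.coord j z < 1 / N ∧ b.coord k z < 1 / N} ≤
        ENNReal.ofReal (C / N ^ 2) := by
  obtain ⟨M, hM⟩ := (CC_simplex b).exists_bound
  set B : Set (Eu n) := Metric.closedBall 0 (5 * M) with hB
  have hBfin : volume B ≠ ⊤ := (isCompact_closedBall _ _).measure_lt_top.ne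
  refine ⟨(volume B).toReal, ENNReal.toReal_nonneg, fun N hN j k hjk => ?_⟩
  have hNr : (0 : ℝ) < N := by exact_mod_cast hN
  obtain ⟨i, hij, hik⟩ : ∃ i : Fin (n + 1), i ≠ j ∧ i ≠ k := by
    have : ({j, k} : Finset (Fin (n + 1))).card < (Finset.univ : Finset (Fin (n + 1))).card := by
      have := Finset.card_le_two (a := j) (b := k)
      simp; omega
    obtain ⟨i, -, hi⟩ := Finset.exists_mem_notMem_of_card_lt_card this
    simp at hi
    exact ⟨i, hi.1, hi.2⟩
  set A : Set (Eu n) := {z | z ∈ convexHull ℝ (Set.range b) ∧ b.coord j z < 1 / N ∧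
    b.coord k z < 1 / N} with hA
  have hcont : ∀ l, Continuous (b.coord l) := fun l => AffineMap.continuous_of_finiteDimensional _
  have hAm : MeasurableSet A := by
    refine MeasurableSet.inter (CC_simplex b).2.1.isClosed.measurableSet ?_
    exact ((isOpen_lt (hcont j) continuous_const).inter
      (isOpen_lt (hcont k) continuous_const)).measurableSet
  set w : Fin N × Fin N → Eu n := fun a =>
    ((a.1 : ℝ) / N) • (b j - b i) + ((a.2 : ℝ) / N) • (b k - b i) with hw
  set s : Fin N × Fin N → Set (Eu n) := fun a => (fun z => z + (- w a)) ⁻¹' A with hs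
  have hsm : ∀ a, MeasurableSet (s a) := fun a => (measurable_add_const (- w a)) hAm
  have hsv : ∀ a, volume (s a) = volume A := fun a => measure_preimage_add_right volume _ _
  have hsj : ∀ a, ∀ z ∈ s a, (a.1 : ℝ) ≤ b.coord j z * N ∧ b.coord j z * N < a.1 + 1 ∧
      (a.2 : ℝ) ≤ b.coord k z * N ∧ b.coord k z * N < a.2 + 1 := by
    intro a z hz
    obtain ⟨h0, h1, h2⟩ := hz
    rw [mem_simplex] at h0
    have h3 := h0 j
    have h4 := h0 k
    rw [coord_add, map_neg] at h1 h2 h3 h4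
    have e1 : (b.coord j).linear (w a) = (a.1 : ℝ) / N := by
      simp only [hw, map_add, map_smul, coord_linear_sub, smul_eq_mul]
      simp [hij.symm, hjk]
    have e2 : (b.coord k).linear (w a) = (a.2 : ℝ) / N := by
      simp only [hw, map_add, map_smul, coord_linear_sub, smul_eq_mul]
      simp [hik.symm, hjk.symm]
    rw [e1] at h1 h3
    rw [e2] at h2 h4
    refine ⟨?_, ?_, ?_, ?_⟩
    · rw [← div_le_iff₀ hNr]; linarith
    · rw [← lt_div_iff₀ hNr, add_div]; linarith
    · rw [← div_le_iff₀ hNr]; linarith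
    · rw [← lt_div_iff₀ hNr, add_div]; linarith
  have hdisj : Pairwise (Function.onFun Disjoint s) := by
    intro a a' haa
    refine Set.disjoint_left.mpr fun z hz hz' => haa ?_
    obtain ⟨h1, h2, h3, h4⟩ := hsj a z hz
    obtain ⟨g1, g2, g3, g4⟩ := hsj a' z hz'
    have key : ∀ (p q : Fin N) (r : ℝ), (p : ℝ) ≤ r → r < p + 1 → (q : ℝ) ≤ r → r < q + 1 →
        p = q := by
      intro p q r k1 k2 k3 k4
      have l1 : ((p : ℕ) : ℝ) < ((q + 1 : ℕ) : ℝ) := by push_cast; linarith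
      have l2 : ((q : ℕ) : ℝ) < ((p + 1 : ℕ) : ℝ) := by push_cast; linarith
      have l1' := Nat.cast_lt.mp l1
      have l2' := Nat.cast_lt.mp l2
      ext; omega
    exact Prod.ext (key _ _ _ h1 h2 g1 g2) (key _ _ _ h3 h4 g3 g4)
  have hbv : ∀ l, ‖b l‖ ≤ M := fun l => hM _ (subset_convexHull ℝ _ ⟨l, rfl⟩)
  have hsB : ∀ a, s a ⊆ B := by
    intro a z hz
    have h1 : ‖z + (- w a)‖ ≤ M := hM _ hz.1
    have hfrac : ∀ p : Fin N, |(p : ℝ) / N| ≤ 1 := by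
      intro p
      rw [abs_of_nonneg (by positivity), div_le_one hNr]
      exact_mod_cast p.2.le
    have h2 : ‖w a‖ ≤ 4 * M := by
      refine (norm_add_le _ _).trans ?_
      rw [norm_smul, norm_smul, Real.norm_eq_abs, Real.norm_eq_abs]
      have k1 : ‖b j - b i‖ ≤ 2 * M := (norm_sub_le _ _).trans (by linarith [hbv j, hbv i])
      have k2 : ‖b k - b i‖ ≤ 2 * M := (norm_sub_le _ _).trans (by linarith [hbv k, hbv i])
      have k3 := mul_le_mul (hfrac a.1) k1 (norm_nonneg _) zero_le_one
      have k4 := mul_le_mul (hfrac a.2) k2 (norm_nonneg _) zero_le_one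
      linarith
    have h3 : z = (z + (- w a)) + w a := by simp
    rw [hB, mem_closedBall_zero_iff, h3]
    refine (norm_add_le _ _).trans (by linarith)
  have hsum : (N ^ 2 : ENNReal) * volume A ≤ volume B := by
    calc (N ^ 2 : ENNReal) * volume A = ∑' a, volume (s a) := by
          rw [tsum_fintype]; simp [hsv, sq]
      _ = volume (⋃ a, s a) := (measure_iUnion hdisj hsm).symm
      _ ≤ volume B := measure_mono (Set.iUnion_subset hsB)
  rw [ENNReal.ofReal_div_of_pos (by positivity), ENNReal.ofReal_toReal hBfin,
    ENNReal.ofReal_pow hNr.le, ENNReal.ofReal_natCast]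
  rw [ENNReal.le_div_iff_mul_le (by left; simp; omega) (by left; simp)]
  rw [mul_comm]; exact hsum

lemma diff_bound (hn : 2 ≤ n) (b : AffineBasis (Fin (n + 1)) ℝ (Eu n)) {P : Set (Eu n)}
    (hPs : P ⊆ convexHull ℝ (Set.range b)) (ht : ∀ i, ∃ p ∈ P, b.coord i p = 0) :
    ∃ C : ℝ, 0 ≤ C ∧ ∀ N : ℕ, 2 ≤ N →
      volume (convexHull ℝ (Set.range b) \
        ((1 - 1 / (N : ℝ)) • convexHull ℝ (Set.range b) + (1 / (N : ℝ)) • P)) ≤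
        ENNReal.ofReal (C / N ^ 2) := by
  obtain ⟨C, hC0, hC⟩ := corner_bound hn b
  set I : Finset (Fin (n + 1) × Fin (n + 1)) := Finset.univ.offDiag with hI
  refine ⟨I.card * C, by positivity, fun N hN => ?_⟩
  have hNr : (2 : ℝ) ≤ N := by exact_mod_cast hN
  set t : ℝ := 1 / (N : ℝ) with htdef
  have ht0 : 0 < t := by positivity
  have ht1 : t < 1 := by rw [htdef, div_lt_one (by linarith)]; linarith
  set Δ := convexHull ℝ (Set.range b) with hΔ
  have hsub : Δ \ ((1 - t) • Δ + t • P) ⊆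
      ⋃ q ∈ I, {z | z ∈ Δ ∧ b.coord q.1 z < t ∧ b.coord q.2 z < t} := by
    rintro z ⟨hz, hzR⟩
    have key : ∀ i, ∃ j, j ≠ i ∧ b.coord j z < t := by
      intro i
      by_contra! hcon
      obtain ⟨p, hp, hpi⟩ := ht i
      have hpc := (mem_simplex b p).mp (hPs hp)
      have hzc := (mem_simplex b z).mp hz
      have hsum : ∀ j, b.coord j p ≤ 1 := by
        intro j
        rw [← b.sum_coord_apply_eq_one p]
        exact Finset.single_le_sum (fun l _ => hpc l) (Finset.mem_univ j)
      set y : Eu n := (1 - t)⁻¹ • (z - t • p) with hy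
      have h1t : (1 - t) ≠ 0 := by linarith
      have hzy : (1 - t) • y + t • p = z := by
        rw [hy, smul_inv_smul₀ h1t]; abel
      refine hzR ?_
      rw [← hzy]
      refine Set.add_mem_add (Set.smul_mem_smul_set ?_) (Set.smul_mem_smul_set hp)
      rw [hΔ, mem_simplex]
      intro j
      have e : b.coord j z = (1 - t) * b.coord j y + t * b.coord j p := by
        conv_lhs => rw [← hzy]
        rw [Convex.combo_affine_apply (by ring)]; rfl
      have h2 : 0 ≤ (1 - t) * b.coord j y := by
        by_cases hji : j = i
        · subst hji; rw [hpi] at e; linarith [hzc j]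
        · have := hcon j hji
          have := mul_le_mul_of_nonneg_left (hsum j) ht0.le
          linarith
      exact nonneg_of_mul_nonneg_right h2 (by linarith)
    obtain ⟨j, -, hj⟩ := key 0
    obtain ⟨k, hkj, hk⟩ := key j
    simp only [Set.mem_iUnion]
    exact ⟨(j, k), by simp [hI, hkj.symm], hz, hj, hk⟩
  calc _ ≤ volume (⋃ q ∈ I, {z | z ∈ Δ ∧ b.coord q.1 z < t ∧ b.coord q.2 z < t}) :=
        measure_mono hsub
    _ ≤ ∑ q ∈ I, volume {z | z ∈ Δ ∧ b.coord q.1 z < t ∧ b.coord q.2 z < t} :=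
        measure_biUnion_finset_le _ _
    _ ≤ ∑ q ∈ I, ENNReal.ofReal (C / N ^ 2) := by
        refine Finset.sum_le_sum fun q hq => ?_
        exact hC N (by omega) q.1 q.2 (by simpa [hI] using hq)
    _ = _ := by
        rw [Finset.sum_const, nsmul_eq_mul, ← ENNReal.ofReal_natCast,
          ← ENNReal.ofReal_mul (by positivity)]
        congr 1; ring

lemma touching_bound (hn : 2 ≤ n) (b : AffineBasis (Fin (n + 1)) ℝ (Eu n)) {P : Set (Eu n)}
    (hP : CC P) (hPs : P ⊆ convexHull ℝ (Set.range b)) (ht : ∀ i, ∃ p ∈ P, b.coord i p = 0)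
    (i : Fin n) :
    (volume (convexHull ℝ (Set.range b))).toReal ≤
      mixedVolume (Function.update (fun _ => convexHull ℝ (Set.range b)) i P) := by
  obtain ⟨C, hC0, hC⟩ := diff_bound hn b hPs ht
  set Δ := convexHull ℝ (Set.range b) with hΔ
  have hΔC : CC Δ := CC_simplex b
  set V := (volume Δ).toReal with hV
  set W := mixedVolume (Function.update (fun _ => Δ) i P) with hW
  have hup : ∀ {X : Set (Eu n)}, CC X → ∀ j, CC (Function.update (fun _ : Fin n => Δ) i X j) := by
    intro X hX j
    by_cases h : j = i
    · subst h; simpa using hX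
    · simpa [h] using hΔC
  have hsc : ∀ {X : Set (Eu n)}, CC X → ∀ c : ℝ, 0 ≤ c →
      mixedVolume (Function.update (fun _ : Fin n => Δ) i (c • X)) =
        c * mixedVolume (Function.update (fun _ : Fin n => Δ) i X) := by
    intro X hX c hc
    have h := mv_smul (hup hX) (c := Function.update (fun _ => 1) i c) (fun j => by
      by_cases h : j = i
      · subst h; simpa using hc
      · simp [h])
    have e : (fun j => Function.update (fun _ : Fin n => (1 : ℝ)) i c j •
        Function.update (fun _ : Fin n => Δ) i X j) =
        Function.update (fun _ : Fin n => Δ) i (c • X) := by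
      ext1 j
      by_cases h : j = i
      · subst h; simp
      · simp [h]
    rw [e] at h
    rw [h]
    congr 1
    simp [Finset.prod_update_of_mem]
  have key : ∀ N : ℕ, 2 ≤ N → V - W ≤ C * (1 / N) := by
    intro N hN
    have hNr : (2 : ℝ) ≤ N := by exact_mod_cast hN
    have hNpos : (0 : ℝ) < N := by linarith
    have hb := hC N hN
    set t : ℝ := 1 / (N : ℝ) with htdef
    have ht0 : 0 < t := by positivity
    have ht1 : t < 1 := by rw [htdef, div_lt_one (by linarith)]; linarith
    set R := (1 - t) • Δ + t • P with hR
    have hRC : CC R := (hΔC.smul _).add (hP.smul _)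
    have hRs : R ⊆ Δ := by
      rintro _ ⟨_, ⟨x, hx, rfl⟩, _, ⟨y, hy, rfl⟩, rfl⟩
      exact hΔC.1 hx (hPs hy) (by linarith) ht0.le (by ring)
    have h1 : (volume R).toReal ≤ (1 - t) * V + t * W := by
      rw [← mv_const hRC]
      calc _ ≤ mixedVolume (Function.update (fun _ : Fin n => Δ) i R) := by
            refine mv_mono (fun _ => hRC) (hup hRC) fun j => ?_
            by_cases h : j = i
            · subst h; simp
            · simpa [h] using hRs
        _ = _ := by
            rw [hR, mv_update_add (fun _ => hΔC) i (hΔC.smul _) (hP.smul _),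
              hsc hΔC _ (by linarith), hsc hP _ ht0.le, hV, ← mv_const hΔC, hW]
            simp
    have h2 : V ≤ (volume R).toReal + C / N ^ 2 := by
      have h3 : volume Δ ≤ volume R + ENNReal.ofReal (C / N ^ 2) := by
        calc volume Δ ≤ volume (R ∪ (Δ \ R)) := measure_mono (by simp)
          _ ≤ volume R + volume (Δ \ R) := measure_union_le _ _
          _ ≤ _ := by gcongr
      have hRfin : volume R ≠ ⊤ := hRC.2.1.measure_lt_top.ne
      have h4 := ENNReal.toReal_mono (by simp [hRfin]) h3
      rwa [ENNReal.toReal_add hRfin (by simp), ENNReal.toReal_ofReal (by positivity)] at h4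
    have h5 : C / (N : ℝ) ^ 2 = t * (C * t) := by rw [htdef]; field_simp
    have h6 : t * (V - W) ≤ t * (C * t) := by linarith
    exact le_of_mul_le_mul_left h6 ht0
  have hlim : Filter.Tendsto (fun N : ℕ => C * (1 / (N : ℝ))) Filter.atTop (nhds (C * 0)) :=
    tendsto_one_div_atTop_nhds_zero_nat.const_mul C
  rw [mul_zero] at hlim
  have := ge_of_tendsto hlim (Filter.eventually_atTop.mpr ⟨2, key⟩)
  linarith

lemma exists_normalize (hn : 2 ≤ n) (b : AffineBasis (Fin (n + 1)) ℝ (Eu n)) {P : Set (Eu n)}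
    (hP : IsConvexBody P) : ∃ (l : ℝ) (x : Eu n) (Q : Set (Eu n)), 0 < l ∧ CC Q ∧
      Q ⊆ convexHull ℝ (Set.range b) ∧ (∀ i, ∃ p ∈ Q, b.coord i p = 0) ∧ P = l • Q + {x} := by
  obtain ⟨hPc, hPk, hPi⟩ := hP
  have hPn : P.Nonempty := hPi.mono interior_subset
  have hcont : ∀ l, Continuous (b.coord l) := fun l => AffineMap.continuous_of_finiteDimensional _
  choose q hq hqm using fun j => hPk.exists_isMinOn hPn (hcont j).continuousOn
  have hmin : ∀ j, ∀ z ∈ P, b.coord j (q j) ≤ b.coord j z := fun j z hz => hqm j hz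
  set m : Fin (n + 1) → ℝ := fun j => b.coord j (q j) with hm
  set x : Eu n := ∑ j, m j • b j with hx
  set l : ℝ := 1 - ∑ j, m j with hl
  have hlpos : 0 < l := by
    obtain ⟨z, hz⟩ := hPi
    have hle : ∑ j, m j ≤ 1 := by
      rw [← b.sum_coord_apply_eq_one z]
      exact Finset.sum_le_sum fun j _ => hmin j z (interior_subset hz)
    rcases hle.lt_or_eq with h | h
    · rw [hl]; linarith
    · exfalso
      have hall : ∀ y ∈ P, y = x := by
        intro y hy
        have h1 : ∑ j, (b.coord j y - m j) = 0 := by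
          rw [Finset.sum_sub_distrib, b.sum_coord_apply_eq_one, h, sub_self]
        have h2 := (Finset.sum_eq_zero_iff_of_nonneg
          (fun j _ => sub_nonneg.mpr (hmin j y hy))).mp h1
        rw [← b.linear_combination_coord_eq_self y, hx]
        refine Finset.sum_congr rfl fun j hj => ?_
        rw [sub_eq_zero.mp (h2 j hj)]
      have hsub : P ⊆ {x} := fun y hy => hall y hy
      have : Nonempty (Fin n) := ⟨⟨0, by omega⟩⟩
      have : Nontrivial (Eu n) := inferInstance
      have : (nhdsWithin x {x}ᶜ).NeBot := Module.punctured_nhds_neBot ℝ (Eu n) x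
      have := interior_mono hsub hz
      rw [interior_singleton] at this
      exact this
  have hcoord : ∀ j z, b.coord j (l • z + x) = l * b.coord j z + m j := by
    intro j z
    have e1 : ∀ w, b.coord j w = b.coord j 0 + (b.coord j).linear w := by
      intro w; simpa using coord_add b j 0 w
    have e2 : (b.coord j).linear x = m j - (1 - l) * b.coord j 0 := by
      have : ∀ k, (b.coord j).linear (b k) = (if j = k then 1 else 0) - b.coord j 0 := by
        intro k
        have := e1 (b k)
        rw [b.coord_apply] at this
        linarith
      rw [hx, map_sum]
      simp only [map_smul, this, smul_eq_mul, mul_sub, Finset.sum_sub_distrib, ← Finset.sum_mul]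
      simp [hl]
    rw [e1 (l • z + x), map_add, map_smul, e2, e1 z, smul_eq_mul]
    ring
  set Q : Set (Eu n) := l⁻¹ • (P + {-x}) with hQ
  have hQmem : ∀ z, z ∈ Q ↔ l • z + x ∈ P := by
    intro z
    rw [hQ, Set.mem_inv_smul_set_iff₀ hlpos.ne']
    simp
  refine ⟨l, x, Q, hlpos, ?_, ?_, ?_, ?_⟩
  · exact ((show CC P from ⟨hPc, hPk, hPn⟩).add (CC.singleton (-x))).smul _
  · intro z hz
    rw [mem_simplex]
    intro j
    have h1 := hmin j _ ((hQmem z).mp hz)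
    rw [hcoord] at h1
    have : 0 ≤ l * b.coord j z := by linarith
    exact nonneg_of_mul_nonneg_right this hlpos
  · intro i
    have e : l • (l⁻¹ • (q i - x)) + x = q i := by
      rw [smul_inv_smul₀ hlpos.ne']; abel
    refine ⟨l⁻¹ • (q i - x), ?_, ?_⟩
    · rw [hQmem, e]; exact hq i
    · have := hcoord i (l⁻¹ • (q i - x))
      rw [e] at this
      have h0 : l * b.coord i (l⁻¹ • (q i - x)) = 0 := by
        have : b.coord i (q i) = m i := rfl
        linarith
      exact (mul_eq_zero.mp h0).resolve_left hlpos.ne'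
  · rw [hQ, smul_inv_smul₀ hlpos.ne', add_assoc, Set.singleton_add_singleton]
    simp

end Simplex

theorem soprunov_zvavitch_simplex (n r : ℕ) (hr : 2 ≤ r) (hrn : r ≤ n)
    (Δ : Set (EuclideanSpace ℝ (Fin n))) (v : Fin (n + 1) → EuclideanSpace ℝ (Fin n))
    (hv : AffineIndependent ℝ v) (hΔ : Δ = convexHull ℝ (Set.range v))
    (P : Fin r → Set (EuclideanSpace ℝ (Fin n))) (hP : ∀ i, IsConvexBody (P i)) :
    (volume Δ).toReal ^ (r - 1) *
      mixedVolume (fun j : Fin n => if h : (j : ℕ) < r then P ⟨(j : ℕ), h⟩ else Δ) ≤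
    ∏ i, mixedVolume (fun j : Fin n => if (j : ℕ) = 0 then P i else Δ) := by
  have hn : 2 ≤ n := hr.trans hrn
  obtain ⟨b, hb⟩ : ∃ b : AffineBasis (Fin (n + 1)) ℝ (Eu n), (b : Fin (n + 1) → Eu n) = v :=
    ⟨⟨v, hv, (hv.affineSpan_eq_top_iff_card_eq_finrank_add_one).mpr (by simp)⟩, rfl⟩
  rw [← hb] at hΔ
  have hΔC : CC Δ := hΔ ▸ CC_simplex b
  set V := (volume Δ).toReal with hV
  have hV0 : 0 ≤ V := ENNReal.toReal_nonneg
  choose l x Q hl hQ hQs hQt hPQ using fun i => exists_normalize hn b (hP i)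
  rw [← hΔ] at hQs
  -- the right-hand factors
  have hR : ∀ i, l i * V ≤ mixedVolume (fun j : Fin n => if (j : ℕ) = 0 then P i else Δ) := by
    intro i
    set i0 : Fin n := ⟨0, by omega⟩ with hi0
    have hj : ∀ j : Fin n, (j : ℕ) = 0 ↔ j = i0 := fun j => by rw [hi0, Fin.ext_iff]
    have h1 := touching_bound hn b (hQ i) (hΔ ▸ hQs i) (hQt i) i0
    rw [← hΔ] at h1
    have hCC : ∀ j, CC (Function.update (fun _ : Fin n => Δ) i0 (Q i) j) := by
      intro j
      by_cases h : j = i0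
      · subst h; simpa using hQ i
      · simpa [h] using hΔC
    have h2 := mv_smul hCC (c := fun j => if j = i0 then l i else 1) (fun j => by
      split_ifs
      · exact (hl i).le
      · exact zero_le_one)
    have h3 := mv_translate (fun j => (if j = i0 then l i else 1) •
      Function.update (fun _ : Fin n => Δ) i0 (Q i) j) (fun j => if j = i0 then x i else 0)
    have e : (fun j : Fin n => if (j : ℕ) = 0 then P i else Δ) =
      (fun j => (if j = i0 then l i else 1) • Function.update (fun _ : Fin n => Δ) i0 (Q i) j +
        {if j = i0 then x i else 0}) := by
      ext1 j
      simp only [hj]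
      by_cases h : j = i0
      · subst h; simpa using hPQ i
      · simp [h]
    rw [e, h3, h2]
    simp only [Finset.prod_ite_eq', Finset.mem_univ, if_true]
    exact mul_le_mul_of_nonneg_left h1 (hl i).le
  -- the left-hand side
  have hL : mixedVolume (fun j : Fin n => if h : (j : ℕ) < r then P ⟨(j : ℕ), h⟩ else Δ) ≤
      (∏ i, l i) * V := by
    set K : Fin n → Set (Eu n) := fun j => if h : (j : ℕ) < r then Q ⟨(j : ℕ), h⟩ else Δ with hK
    set c : Fin n → ℝ := fun j => if h : (j : ℕ) < r then l ⟨(j : ℕ), h⟩ else 1 with hc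
    set y : Fin n → Eu n := fun j => if h : (j : ℕ) < r then x ⟨(j : ℕ), h⟩ else 0 with hy
    have hKC : ∀ j, CC (K j) := by
      intro j; simp only [hK]; split_ifs
      · exact hQ _
      · exact hΔC
    have hKs : ∀ j, K j ⊆ Δ := by
      intro j; simp only [hK]; split_ifs
      · exact hQs _
      · exact subset_rfl
    have hc0 : ∀ j, 0 ≤ c j := by
      intro j; simp only [hc]; split_ifs
      · exact (hl _).le
      · exact zero_le_one
    have e : (fun j : Fin n => if h : (j : ℕ) < r then P ⟨(j : ℕ), h⟩ else Δ) =
        fun j => c j • K j + {y j} := by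
      ext1 j
      simp only [hK, hc, hy]
      split_ifs with h
      · exact hPQ _
      · simp
    have hprod : ∏ j, c j = ∏ i, l i := by
      obtain ⟨k, rfl⟩ := Nat.exists_eq_add_of_le hrn
      rw [Fin.prod_univ_add]
      simp [hc]
    rw [e, mv_translate (fun j => c j • K j) y, mv_smul hKC hc0, hprod]
    refine mul_le_mul_of_nonneg_left ?_ (Finset.prod_nonneg fun i _ => (hl i).le)
    rw [hV, ← mv_const hΔC]
    exact mv_mono hKC (fun _ => hΔC) hKs
  calc _ ≤ V ^ (r - 1) * ((∏ i, l i) * V) := mul_le_mul_of_nonneg_left hL (pow_nonneg hV0 _)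
    _ = ∏ i, (l i * V) := by
        rw [Finset.prod_mul_distrib, Finset.prod_const, Finset.card_univ, Fintype.card_fin]
        obtain ⟨k, rfl⟩ := Nat.exists_eq_add_of_le hr
        have : 2 + k - 1 = k + 1 := by omega
        rw [this]; ring
    _ ≤ _ := Finset.prod_le_prod (fun i _ => mul_nonneg (hl i).le hV0) (fun i _ => hR i)
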